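/- There exists a constant c > 0, depending only on the structural parameters N₀, c₀, β, with the following property. Let R₁,…,R_m (m ≤ n) and R'₁,…,R'_{m'} (m' ≤ n) be two families of rings, each family consisting of rings with pairwise disjoint interiors whose union is Ω. Let 𝒰 be the collection of all maximal compact connected subsets U of Ω obtained by intersecting rings from the two families (i.e., U is a connected component of some R_i ∩ R'_j) satisfying U = closure(interior(U)), where maximal means U is not contained in another such set. Then the cardinality of 𝒰 is at most c·n. -/

import Mathlib

open scoped Classical

open Set Metric MeasureTheory ENNReal

noncomputable section

/-- The Euclidean plane `ℝ²`. -/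
abbrev Plane : Type := EuclideanSpace ℝ (Fin 2)

/-- `Q` is a compact regular convex set whose boundary is a polygon consisting of at most
`N₀` line segments, with eccentricity bounded by `c₀`. -/
def IsRegularConvexPolygon (N₀ : ℕ) (c₀ : ℝ) (Q : Set Plane) : Prop :=
  IsCompact Q ∧ Convex ℝ Q ∧ Q.Nonempty ∧
    (∃ (m : ℕ) (v w : Fin m → Plane), m ≤ N₀ ∧ frontier Q = ⋃ i, segment ℝ (v i) (w i)) ∧
    (∃ (x₁ x₂ : Plane) (r₁ r₂ : ℝ), 0 < r₂ ∧
      closedBall x₂ r₂ ⊆ Q ∧ Q ⊆ closedBall x₁ r₁ ∧ r₁ ≤ c₀ * r₂)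

/-- There is a triangle contained in `R` having the segment `[a,b]` as a side, whose two
angles adjacent to that side are equal to `β`. -/
def HasGoodTriangle (β : ℝ) (R : Set Plane) (a b : Plane) : Prop :=
  ∃ c : Plane, convexHull ℝ {a, b, c} ⊆ R ∧
    EuclideanGeometry.angle b a c = β ∧ EuclideanGeometry.angle a b c = β

/-- `R ⊆ ℝ²` is a ring with structural parameters `N₀`, `c₀`, `β`: the difference of two
regular compact convex sets with polygonal boundaries, admitting no uncontrollably narrow
elongated subregions (each maximal edge of the boundary can be subdivided into at most two
segments, each carrying a good triangle with adjacent angles `β` inside `R`). -/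
def IsRing (N₀ : ℕ) (c₀ β : ℝ) (R : Set Plane) : Prop :=
  (∃ Q₁ Q₂ : Set Plane,
      IsRegularConvexPolygon N₀ c₀ Q₁ ∧
      (Q₂ = ∅ ∨ (Q₂ ⊆ Q₁ ∧ IsRegularConvexPolygon N₀ c₀ Q₂)) ∧
      R = Q₁ \ interior Q₂) ∧
  (∃ (m : ℕ) (v w : Fin m → Plane),
      frontier R = ⋃ i, segment ℝ (v i) (w i) ∧
      (∀ i, ∀ a b : Plane, segment ℝ (v i) (w i) ⊆ segment ℝ a b →
        segment ℝ a b ⊆ frontier R → segment ℝ a b = segment ℝ (v i) (w i)) ∧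
      (∀ i, ∃ p ∈ segment ℝ (v i) (w i),
        HasGoodTriangle β R (v i) p ∧ HasGoodTriangle β R p (w i)))

/-- `Ω` is the union of `n` rings with pairwise disjoint interiors. -/
def IsRingDecomp (N₀ : ℕ) (c₀ β : ℝ) (n : ℕ) (Ω : Set Plane) : Prop :=
  ∃ R : Fin n → Set Plane,
    (∀ j, IsRing N₀ c₀ β (R j)) ∧
    (∀ i j, i ≠ j → interior (R i) ∩ interior (R j) = ∅) ∧
    (⋃ j, R j) = Ω

/-- Membership in the nonlinear spline class `S(n,k)`: piecewise polynomials of total degree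
`< k` over `n` rings with pairwise disjoint interiors whose union is `Ω` (or, when `Ω = ℝ²`,
whose union -- the support of the spline -- is itself a ring), having maximum smoothness
`W^{k-2}(Ω)` when `k ≥ 2` (no smoothness is required for piecewise constants, `k = 1`). -/
def IsSpline (N₀ : ℕ) (c₀ β : ℝ) (n k : ℕ) (Ω : Set Plane) (S : Plane → ℝ) : Prop :=
  ∃ (R : Fin n → Set Plane) (P : Fin n → MvPolynomial (Fin 2) ℝ),
    (∀ j, IsRing N₀ c₀ β (R j)) ∧
    (∀ i j, i ≠ j → interior (R i) ∩ interior (R j) = ∅) ∧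
    ((⋃ j, R j) = Ω ∨ (Ω = Set.univ ∧ IsRing N₀ c₀ β (⋃ j, R j))) ∧
    (∀ j, (P j).totalDegree < k) ∧
    (S = fun x => ∑ j, (R j).indicator (fun y => MvPolynomial.eval (fun i => y i) (P j)) x) ∧
    (2 ≤ k → ContDiffOn ℝ ((k - 2 : ℕ) : ℕ∞) S Ω)

/-- The spline class `S(n,k,r)` with defect: smoothness `W^r(Ω)` instead of the maximal
smoothness `W^{k-2}(Ω)`. -/
def IsSplineDefect (N₀ : ℕ) (c₀ β : ℝ) (n k r : ℕ) (Ω : Set Plane) (S : Plane → ℝ) : Prop :=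
  ∃ (R : Fin n → Set Plane) (P : Fin n → MvPolynomial (Fin 2) ℝ),
    (∀ j, IsRing N₀ c₀ β (R j)) ∧
    (∀ i j, i ≠ j → interior (R i) ∩ interior (R j) = ∅) ∧
    ((⋃ j, R j) = Ω ∨ (Ω = Set.univ ∧ IsRing N₀ c₀ β (⋃ j, R j))) ∧
    (∀ j, (P j).totalDegree < k) ∧
    (S = fun x => ∑ j, (R j).indicator (fun y => MvPolynomial.eval (fun i => y i) (P j)) x) ∧
    ContDiffOn ℝ ((r : ℕ) : ℕ∞) S Ω

/-- The `L^p(Ω)` quasi-norm, `0 < p < ∞`. -/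
def lpNormE (p : ℝ) (Ω : Set Plane) (f : Plane → ℝ) : ℝ≥0∞ :=
  eLpNorm f (ENNReal.ofReal p) (volume.restrict Ω)

/-- `k`-th finite difference `Δ_h^k f(x)`, set to `0` unless the segment `[x, x+kh] ⊆ Ω`. -/
def deltah (Ω : Set Plane) (k : ℕ) (h : Plane) (f : Plane → ℝ) (x : Plane) : ℝ :=
  if segment ℝ x (x + (k : ℝ) • h) ⊆ Ω then
    ∑ ν ∈ Finset.range (k + 1), (-1 : ℝ) ^ (k + ν) * (k.choose ν : ℝ) * f (x + (ν : ℝ) • h)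
  else 0

/-- Modulus of smoothness `ω_k(f,t)_τ = sup_{|h| ≤ t} ‖Δ_h^k f‖_{L^τ(Ω)}`. -/
def modulus (Ω : Set Plane) (k : ℕ) (τ : ℝ) (f : Plane → ℝ) (t : ℝ) : ℝ≥0∞ :=
  ⨆ (h : Plane) (_ : ‖h‖ ≤ t), lpNormE τ Ω (deltah Ω k h f)

/-- Besov seminorm `|f|_{B^{s,k}_τ} = (∫₀^∞ [t^{-s} ω_k(f,t)_τ]^τ dt/t)^{1/τ}`. -/
def besovSeminorm (Ω : Set Plane) (k : ℕ) (s τ : ℝ) (f : Plane → ℝ) : ℝ≥0∞ :=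
  (∫⁻ t in Set.Ioi (0 : ℝ),
      (ENNReal.ofReal (t ^ (-s)) * modulus Ω k τ f t) ^ τ / ENNReal.ofReal t) ^ (1 / τ)

/-- Error of best `L^p(Ω)`-approximation `S_n^k(f)_p` from the spline class `S(n,k)`. -/
def splineApprox (N₀ : ℕ) (c₀ β : ℝ) (n k : ℕ) (p : ℝ) (Ω : Set Plane) (f : Plane → ℝ) :
    ℝ≥0∞ :=
  ⨅ (S : Plane → ℝ) (_ : IsSpline N₀ c₀ β n k Ω S), lpNormE p Ω fun x => f x - S x

/-- The K-functional `K(f,t; L^p(Ω), B^{s,k}_τ)`. -/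
def kFunctional (Ω : Set Plane) (k : ℕ) (s τ p : ℝ) (f : Plane → ℝ) (t : ℝ) : ℝ≥0∞ :=
  ⨅ g : Plane → ℝ,
    lpNormE p Ω (fun x => f x - g x) + ENNReal.ofReal t * besovSeminorm Ω k s τ g

/-- BV seminorm: the total mass of the distributional gradient of `g` on `Ω`, defined by
duality against compactly supported `C¹` vector fields of norm at most one. -/
def bvSeminorm (Ω : Set Plane) (g : Plane → ℝ) : ℝ≥0∞ :=
  ⨆ (φ : Plane → Plane) (_ : ContDiff ℝ 1 φ ∧ HasCompactSupport φ ∧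
      tsupport φ ⊆ interior Ω ∧ ∀ x, ‖φ x‖ ≤ 1),
    ENNReal.ofReal (∫ x in Ω, g x * ∑ i, fderiv ℝ φ x (EuclideanSpace.single i 1) i)

/-- The K-functional `K(f,t; L²(Ω), BV(Ω))`. -/
def kFunctionalBV (Ω : Set Plane) (f : Plane → ℝ) (t : ℝ) : ℝ≥0∞ :=
  ⨅ g : Plane → ℝ,
    lpNormE 2 Ω (fun x => f x - g x) + ENNReal.ofReal t * bvSeminorm Ω g

/-- `U` is a connected component of `A`: a maximal nonempty preconnected subset of `A`. -/
def IsConnCompOf (A U : Set Plane) : Prop :=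
  U ⊆ A ∧ U.Nonempty ∧ IsPreconnected U ∧
    ∀ V : Set Plane, U ⊆ V → V ⊆ A → IsPreconnected V → V = U

/-- A triangle with two equal base angles `β ≤ π / 3` contains a ball around its centroid whose
radius is comparable to the length of the base, and its legs are no longer than the base. -/
theorem ball_subset_convexHull_of_angle_eq {β : ℝ} (hβ : 0 < β) (hβ' : β ≤ Real.pi / 3)
    {a b c : Plane} (hab : a ≠ b) (h₁ : EuclideanGeometry.angle b a c = β)
    (h₂ : EuclideanGeometry.angle a b c = β) :
    ball ((1 / 3 : ℝ) • (a + b + c)) (Real.tan β / 12 * dist a b) ⊆ convexHull ℝ {a, b, c} ∧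
      dist a c ≤ dist a b := by
  have hC : 1 / 2 ≤ Real.cos β := by
    rw [← Real.cos_pi_div_three]
    exact Real.cos_le_cos_of_nonneg_of_le_pi hβ.le (by linarith [Real.pi_pos]) hβ'
  have hS : 0 < Real.sin β := Real.sin_pos_of_pos_of_lt_pi hβ (by linarith [Real.pi_pos])
  have hsc := Real.sin_sq_add_cos_sq β
  have e₁ := InnerProductGeometry.cos_angle_mul_norm_mul_norm (b -ᵥ a) (c -ᵥ a)
  have e₂ := InnerProductGeometry.cos_angle_mul_norm_mul_norm (a -ᵥ b) (c -ᵥ b)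
  change Real.cos (EuclideanGeometry.angle b a c) * _ = _ at e₁
  change Real.cos (EuclideanGeometry.angle a b c) * _ = _ at e₂
  rw [h₁] at e₁
  rw [h₂] at e₂
  have hN : 0 < dist a b := dist_pos.2 hab
  have hW : 0 ≤ dist a c := dist_nonneg
  have n₁ : dist a b ^ 2 = (b 0 - a 0) ^ 2 + (b 1 - a 1) ^ 2 := by
    rw [dist_comm, dist_eq_norm, EuclideanSpace.norm_sq_eq]; simp [Fin.sum_univ_two]
  have n₂ : dist a c ^ 2 = (c 0 - a 0) ^ 2 + (c 1 - a 1) ^ 2 := by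
    rw [dist_comm, dist_eq_norm, EuclideanSpace.norm_sq_eq]; simp [Fin.sum_univ_two]
  have n₃ : dist b c ^ 2 = (c 0 - b 0) ^ 2 + (c 1 - b 1) ^ 2 := by
    rw [dist_comm, dist_eq_norm, EuclideanSpace.norm_sq_eq]; simp [Fin.sum_univ_two]
  simp only [vsub_eq_sub, ← dist_eq_norm, PiLp.inner_apply, Fin.sum_univ_two, PiLp.sub_apply,
    RCLike.inner_apply, conj_trivial] at e₁ e₂
  rw [dist_comm b a, dist_comm c a] at e₁
  rw [dist_comm c b] at e₂
  generalize dist a b = N at *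
  generalize dist a c = W at *
  generalize dist b c = Z at *
  have hp : (c 0 - a 0) * (b 0 - a 0) + (c 1 - a 1) * (b 1 - a 1) = N ^ 2 / 2 := by
    have k₁ : (Real.cos β * (N * W)) ^ 2 - (Real.cos β * (N * Z)) ^ 2 =
        Real.cos β ^ 2 * N ^ 2 * (W ^ 2 - Z ^ 2) := by ring
    have k₂ : Real.sin β ^ 2 * N ^ 2 *
        (N ^ 2 - 2 * ((c 0 - a 0) * (b 0 - a 0) + (c 1 - a 1) * (b 1 - a 1))) = 0 := by
      rw [e₁, e₂, n₁, n₂, n₃] at k₁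
      rw [n₁, show Real.sin β ^ 2 = 1 - Real.cos β ^ 2 by linarith]
      linear_combination -k₁
    have : Real.sin β ^ 2 * N ^ 2 ≠ 0 := by positivity
    have := (mul_eq_zero.1 k₂).resolve_left this
    linarith
  have hW2 : Real.cos β * W = N / 2 := by
    have : N * (Real.cos β * W) = N * (N / 2) := by linarith
    exact mul_left_cancel₀ hN.ne' this
  have hWN : W ≤ N := by nlinarith
  refine ⟨?_, hWN⟩
  set q : ℝ := (b 0 - a 0) * (c 1 - a 1) - (b 1 - a 1) * (c 0 - a 0) with hq
  have hC0 : 0 < Real.cos β := by linarith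
  have hqabs : |q| = N ^ 2 * Real.tan β / 2 := by
    have ht : 0 < Real.tan β := by rw [Real.tan_eq_sin_div_cos]; positivity
    rw [← abs_of_pos (show 0 < N ^ 2 * Real.tan β / 2 by positivity), ← sq_eq_sq_iff_abs_eq_abs]
    have : q ^ 2 = N ^ 2 * W ^ 2 - (N ^ 2 / 2) ^ 2 := by rw [← hp, n₁, n₂]; ring
    rw [this, Real.tan_eq_sin_div_cos, show W = N / 2 / Real.cos β by
      rw [← hW2]; field_simp]
    field_simp
    linear_combination (-1 : ℝ) * hsc
  have hq0 : 0 < |q| := by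
    rw [hqabs, Real.tan_eq_sin_div_cos]; positivity
  have hqne : q ≠ 0 := abs_pos.1 hq0
  intro y hy
  obtain ⟨d, rfl⟩ : ∃ d, y = (1 / 3 : ℝ) • (a + b + c) + d := ⟨_, (add_sub_cancel _ _).symm⟩
  rw [mem_ball, dist_eq_norm, add_sub_cancel_left] at hy
  have nd : ‖d‖ ^ 2 = d 0 ^ 2 + d 1 ^ 2 := by
    rw [EuclideanSpace.norm_sq_eq]; simp [Fin.sum_univ_two]
  have hd0 := norm_nonneg d
  have key : ∀ v₀ v₁ V : ℝ, 0 ≤ V → V ≤ N → V ^ 2 = v₀ ^ 2 + v₁ ^ 2 →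
      |(v₀ * d 1 - v₁ * d 0) / q| ≤ 1 / 6 := by
    intro v₀ v₁ V hV hVN hv
    have : |v₀ * d 1 - v₁ * d 0| ≤ ‖d‖ * V := by
      apply abs_le_of_sq_le_sq _ (by positivity)
      rw [mul_pow, hv, nd]
      nlinarith [sq_nonneg (v₀ * d 0 + v₁ * d 1)]
    rw [abs_div, div_le_iff₀ hq0, hqabs]
    refine this.trans ?_
    calc ‖d‖ * V ≤ (Real.tan β / 12 * N) * N :=
          mul_le_mul hy.le hVN hV (hd0.trans hy.le)
      _ = _ := by ring
  have kμ := abs_le.1 (key _ _ N hN.le le_rfl n₁)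
  have kl := abs_le.1 (key _ _ W hW hWN n₂)
  set μ := ((b 0 - a 0) * d 1 - (b 1 - a 1) * d 0) / q with hμ
  set l := ((c 0 - a 0) * d 1 - (c 1 - a 1) * d 0) / q with hl
  have hmem := (convex_convexHull ℝ ({a, b, c} : Set Plane)).sum_mem
    (t := Finset.univ) (w := ![1 / 3 + l - μ, 1 / 3 - l, 1 / 3 + μ]) (z := ![a, b, c])
    (by intro i _; fin_cases i <;> simp <;> linarith) (by simp [Fin.sum_univ_three]; ring)
    (by intro i _; apply subset_convexHull; fin_cases i <;> simp)
  convert hmem using 1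
  simp only [Fin.sum_univ_three]
  ext i
  have hμq : μ * q = (b 0 - a 0) * d 1 - (b 1 - a 1) * d 0 := div_mul_cancel₀ _ hqne
  have hlq : l * q = (c 0 - a 0) * d 1 - (c 1 - a 1) * d 0 := div_mul_cancel₀ _ hqne
  apply mul_right_cancel₀ hqne
  fin_cases i
  · simp [-mul_eq_mul_right_iff]
    linear_combination (b 0 - a 0) * hlq - (c 0 - a 0) * hμq + d 0 * hq
  · simp [-mul_eq_mul_right_iff]
    linear_combination (b 1 - a 1) * hlq - (c 1 - a 1) * hμq + d 1 * hq

/-- The segments carrying a good triangle are nondegenerate. -/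
theorem HasGoodTriangle.ne {β : ℝ} (hβ' : β ≤ Real.pi / 3) {R : Set Plane} {a b : Plane}
    (h : HasGoodTriangle β R a b) : a ≠ b := by
  rintro rfl
  obtain ⟨c, -, h, -⟩ := h
  rw [EuclideanGeometry.angle_self_left] at h
  linarith [Real.pi_pos]

/-- Near every point of a segment carrying a good triangle, `R` contains balls of radius
comparable to any prescribed scale not exceeding the length of the segment. -/
theorem HasGoodTriangle.exists_ball_subset {β : ℝ} (hβ : 0 < β) (hβ' : β ≤ Real.pi / 3)
    {R : Set Plane} {a b x : Plane} (h : HasGoodTriangle β R a b) (hx : x ∈ segment ℝ a b)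
    {l : ℝ} (hl : 0 < l) (hlab : l ≤ dist a b) :
    ∃ z, dist z x ≤ 2 * l ∧ ball z (Real.tan β / 12 * l) ⊆ R := by
  have hab := h.ne hβ'
  obtain ⟨c, hR, h₁, h₂⟩ := h
  obtain ⟨hball, hle⟩ := ball_subset_convexHull_of_angle_eq hβ hβ' hab h₁ h₂
  have hN : 0 < dist a b := dist_pos.2 hab
  have hconv := convex_convexHull ℝ ({a, b, c} : Set Plane)
  have ht : 0 < Real.tan β := Real.tan_pos_of_pos_of_lt_pi_div_two hβ (by linarith [Real.pi_pos])
  have hxT : x ∈ convexHull ℝ ({a, b, c} : Set Plane) :=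
    hconv.segment_subset (subset_convexHull _ _ (by simp)) (subset_convexHull _ _ (by simp)) hx
  have hsub : convexHull ℝ ({a, b, c} : Set Plane) ⊆ closedBall a (dist a b) := by
    refine convexHull_min ?_ (convex_closedBall _ _)
    rintro y (rfl | rfl | rfl)
    · simp
    · simp [dist_comm]
    · simpa [dist_comm] using hle
  set g : Plane := (1 / 3 : ℝ) • (a + b + c) with hg
  have hgT : g ∈ convexHull ℝ ({a, b, c} : Set Plane) :=
    hball (mem_ball_self (by positivity))
  have hgx : dist g x ≤ 2 * dist a b := by
    have := mem_closedBall.1 (hsub hgT)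
    have := mem_closedBall.1 (hsub hxT)
    linarith [dist_triangle_right g x a]
  set t : ℝ := l / dist a b with ht'
  have ht0 : 0 < t := by positivity
  have ht1 : t ≤ 1 := (div_le_one hN).2 hlab
  have htl : t * dist a b = l := div_mul_cancel₀ _ hN.ne'
  refine ⟨AffineMap.homothety x t g, ?_, ?_⟩
  · rw [dist_homothety_center, Real.norm_of_nonneg ht0.le]
    rw [dist_comm] at hgx
    nlinarith
  · intro y hy
    apply hR
    have hy' : x + t⁻¹ • (y - x) ∈ ball g (Real.tan β / 12 * dist a b) := by
      rw [mem_ball, dist_eq_norm] at hy ⊢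
      have : x + t⁻¹ • (y - x) - g = t⁻¹ • (y - AffineMap.homothety x t g) := by
        simp only [AffineMap.homothety_apply, vsub_eq_sub, vadd_eq_add, smul_sub, smul_add,
          smul_smul, inv_mul_cancel₀ ht0.ne', one_smul]
        abel
      rw [this, norm_smul, norm_inv, Real.norm_of_nonneg ht0.le, inv_mul_lt_iff₀ ht0]
      calc _ < _ := hy
        _ = _ := by rw [← htl]; ring
    have := hconv.add_smul_sub_mem hxT (hball hy') ⟨ht0.le, ht1⟩
    simpa [smul_smul, mul_inv_cancel₀ ht0.ne'] using this

/-- **Packing.** Only boundedly many sets with pairwise disjoint interiors contain a ball of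
radius `δ * l` centred at distance at most `3 * l` from a given point. -/
theorem exists_card_filter_ball_subset_le {δ : ℝ} (hδ : 0 < δ) :
    ∃ K : ℕ, ∀ {κ : Type} [Fintype κ] (S : κ → Set Plane),
      (∀ i j, i ≠ j → interior (S i) ∩ interior (S j) = ∅) → ∀ (p : Plane) {l : ℝ}, 0 < l →
      (Finset.univ.filter fun j => ∃ z, dist z p ≤ 3 * l ∧ ball z (δ * l) ⊆ S j).card ≤ K := by
  obtain ⟨t, -, ht, hcov⟩ :=
    finite_approx_of_totallyBounded (isCompact_closedBall (0 : Plane) 3).totallyBounded δ hδ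
  refine ⟨ht.toFinset.card, fun {κ} _ S hS p l hl => ?_⟩
  have key : ∀ j, (∃ z, dist z p ≤ 3 * l ∧ ball z (δ * l) ⊆ S j) →
      ∃ w ∈ t, p + l • w ∈ interior (S j) := by
    rintro j ⟨z, hz, hzS⟩
    have hz' : l⁻¹ • (z - p) ∈ closedBall (0 : Plane) 3 := by
      rw [mem_closedBall_zero_iff, norm_smul, norm_inv, Real.norm_of_nonneg hl.le,
        inv_mul_le_iff₀ hl, ← dist_eq_norm]
      linarith
    obtain ⟨w, hw, hzw⟩ := mem_iUnion₂.1 (hcov hz')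
    refine ⟨w, hw, interior_maximal hzS isOpen_ball ?_⟩
    rw [mem_ball, dist_eq_norm] at hzw ⊢
    have : p + l • w - z = l • (w - l⁻¹ • (z - p)) := by
      rw [smul_sub, smul_smul, mul_inv_cancel₀ hl.ne', one_smul]; abel
    rw [this, norm_smul, Real.norm_of_nonneg hl.le, norm_sub_rev, mul_comm δ]
    gcongr
  choose! f hft hf using key
  refine Finset.card_le_card_of_injOn f (fun j hj => ?_) (fun i hi j hj hij => ?_)
  · simp only [Finset.coe_filter, Finset.mem_univ, true_and, mem_ofPred_eq] at hj
    simpa using hft j hj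
  · simp only [Finset.coe_filter, Finset.mem_univ, true_and, mem_ofPred_eq] at hi hj
    by_contra hne
    have : p + l • f j ∈ interior (S i) ∩ interior (S j) := ⟨hij ▸ hf i hi, hf j hj⟩
    simp [hS i j hne] at this

/-- A point of a segment splits it into two segments. -/
theorem segment_subset_union_of_mem {v w p : Plane} (hp : p ∈ segment ℝ v w) :
    segment ℝ v w ⊆ segment ℝ v p ∪ segment ℝ p w := by
  intro x hx
  rw [segment_eq_image_lineMap] at hp hx
  obtain ⟨t, ht, rfl⟩ := hp
  obtain ⟨s, hs, rfl⟩ := hx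
  have h₁ := image_segment ℝ (AffineMap.lineMap (k := ℝ) v w) 0 t
  have h₂ := image_segment ℝ (AffineMap.lineMap (k := ℝ) v w) t 1
  rw [AffineMap.lineMap_apply_zero, segment_eq_Icc ht.1] at h₁
  rw [AffineMap.lineMap_apply_one, segment_eq_Icc ht.2] at h₂
  rw [← h₁, ← h₂]
  rcases le_total s t with h | h
  · exact Or.inl (mem_image_of_mem _ ⟨hs.1, h⟩)
  · exact Or.inr (mem_image_of_mem _ ⟨h, hs.2⟩)

/-- Two segments with two distinct common points have a segment as their union. -/
theorem exists_segment_eq_union {v w v' w' y z : Plane} (hyz : y ≠ z)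
    (hy : y ∈ segment ℝ v w) (hz : z ∈ segment ℝ v w)
    (hy' : y ∈ segment ℝ v' w') (hz' : z ∈ segment ℝ v' w') :
    ∃ a b, segment ℝ a b = segment ℝ v w ∪ segment ℝ v' w' := by
  have key : ∀ {v w : Plane}, y ∈ segment ℝ v w → z ∈ segment ℝ v w → ∃ s t : ℝ,
      AffineMap.lineMap y z '' uIcc s t = segment ℝ v w ∧ (0 : ℝ) ∈ uIcc s t := by
    intro v w hy hz
    have hyS := hy
    rw [segment_eq_image_lineMap] at hy hz
    obtain ⟨α, -, hα⟩ := hy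
    obtain ⟨γ, -, hγ⟩ := hz
    have hne : γ - α ≠ 0 := fun h => hyz (by rw [← hα, ← hγ, sub_eq_zero.1 h])
    have hline : ∀ s : ℝ, (AffineMap.lineMap y z s : Plane) =
        AffineMap.lineMap v w (α + s * (γ - α)) := by
      intro s
      rw [← hα, ← hγ]
      simp only [AffineMap.lineMap_apply_module]
      module
    have himg : AffineMap.lineMap y z '' uIcc (-α / (γ - α)) ((1 - α) / (γ - α)) =
        segment ℝ v w := by
      rw [← segment_eq_uIcc, image_segment, hline, hline, div_mul_cancel₀ _ hne,
        div_mul_cancel₀ _ hne]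
      simp
    refine ⟨_, _, himg, ?_⟩
    rw [← himg] at hyS
    obtain ⟨r, hr, hry⟩ := hyS
    have : r = 0 := AffineMap.lineMap_injective ℝ hyz (by simpa using hry)
    rwa [this] at hr
  obtain ⟨s, t, h, h0⟩ := key hy hz
  obtain ⟨s', t', h', h0'⟩ := key hy' hz'
  rw [← h, ← h', ← image_union]
  rw [uIcc, mem_Icc] at h0 h0'
  refine ⟨AffineMap.lineMap y z (min (s ⊓ t) (s' ⊓ t')),
    AffineMap.lineMap y z (max (s ⊔ t) (s' ⊔ t')), ?_⟩
  rw [← image_segment, segment_eq_Icc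
    ((min_le_left _ _).trans (h0.1.trans (h0.2.trans (le_max_left _ _)))), uIcc, uIcc,
    Icc_union_Icc' (h0'.1.trans h0.2) (h0.1.trans h0'.2)]

/-- The frontier of a set `Q₁ \ interior Q₂` as in the definition of a ring. -/
theorem frontier_diff_interior {Q₁ Q₂ : Set Plane} (h₁ : IsClosed Q₁) (h₂ : IsClosed Q₂)
    (hsub : Q₂ ⊆ Q₁) (hreg : Q₂ ⊆ closure (interior Q₂)) :
    frontier (Q₁ \ interior Q₂) = frontier Q₁ ∪ frontier Q₂ := by
  have hcl : IsClosed (Q₁ \ interior Q₂) := h₁.sdiff isOpen_interior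
  rw [hcl.frontier_eq, h₁.frontier_eq, h₂.frontier_eq]
  have hint : interior (Q₁ \ interior Q₂) = interior Q₁ \ Q₂ := by
    rw [sdiff_eq, interior_inter, interior_compl, sdiff_eq]
    congr 2
    exact (closure_minimal interior_subset h₂).antisymm hreg
  rw [hint]
  ext x
  have h₃ := @hsub x
  have h₄ := @interior_mono _ _ _ _ hsub x
  have h₅ := @interior_subset _ _ Q₂ x
  have h₆ := @interior_subset _ _ Q₁ x
  simp only [mem_sdiff, mem_union]
  tauto

/-- A regular convex polygon is closed, the closure of its interior, and its frontier is a union of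
at most `N₀` segments. -/
theorem IsRegularConvexPolygon.exists_finset {N₀ : ℕ} {c₀ : ℝ} {Q : Set Plane}
    (h : IsRegularConvexPolygon N₀ c₀ Q) :
    IsClosed Q ∧ Q ⊆ closure (interior Q) ∧ ∃ T : Finset (Plane × Plane), T.card ≤ N₀ ∧
      frontier Q = ⋃ q ∈ T, segment ℝ q.1 q.2 := by
  obtain ⟨hc, hconv, -, ⟨m, v, w, hm, hf⟩, ⟨x₁, x₂, r₁, r₂, hr, hb, -⟩⟩ := h
  refine ⟨hc.isClosed, ?_, Finset.univ.image fun i => (v i, w i), ?_, ?_⟩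
  · rw [hconv.closure_interior_eq_closure_of_nonempty_interior]
    · exact subset_closure
    · exact ⟨x₂, interior_maximal (ball_subset_closedBall.trans hb) isOpen_ball
        (mem_ball_self hr)⟩
  · exact Finset.card_image_le.trans (by simpa using hm)
  · rw [hf]; simp

/-- A ring is closed and its frontier is covered by at most `4 * N₀` segments carrying a good
triangle. -/
theorem IsRing.exists_edges {N₀ : ℕ} {c₀ β : ℝ} (hβ' : β ≤ Real.pi / 3) {R : Set Plane}
    (h : IsRing N₀ c₀ β R) :
    IsClosed R ∧ ∃ P : Finset (Plane × Plane), P.card ≤ 4 * N₀ ∧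
      (∀ q ∈ P, HasGoodTriangle β R q.1 q.2) ∧ frontier R ⊆ ⋃ q ∈ P, segment ℝ q.1 q.2 := by
  obtain ⟨⟨Q₁, Q₂, h₁, h₂, rfl⟩, m, v, w, hfr, hmax, htri⟩ := h
  obtain ⟨hc₁, -, T₁, hT₁, hf₁⟩ := h₁.exists_finset
  refine ⟨hc₁.sdiff isOpen_interior, ?_⟩
  obtain ⟨T, hT, hfT⟩ : ∃ T : Finset (Plane × Plane), T.card ≤ 2 * N₀ ∧
      frontier (Q₁ \ interior Q₂) = ⋃ q ∈ T, segment ℝ q.1 q.2 := by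
    rcases h₂ with rfl | ⟨hsub, h₂⟩
    · exact ⟨T₁, by lia, by simpa using hf₁⟩
    · obtain ⟨hc₂, hreg, T₂, hT₂, hf₂⟩ := h₂.exists_finset
      refine ⟨T₁ ∪ T₂, (Finset.card_union_le _ _).trans (by lia), ?_⟩
      rw [frontier_diff_interior hc₁ hc₂ hsub hreg, hf₁, hf₂, Finset.set_biUnion_union]
  set R := Q₁ \ interior Q₂
  choose p hp htri₁ htri₂ using htri
  have hex : ∀ i, ∃ q ∈ T, ∃ y z, y ≠ z ∧ y ∈ segment ℝ q.1 q.2 ∧ z ∈ segment ℝ q.1 q.2 ∧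
      segment ℝ q.1 q.2 ⊆ segment ℝ (v i) (w i) := by
    intro i
    have hinf : (segment ℝ (v i) (w i)).Infinite := by
      have hsub : segment ℝ (v i) (p i) ⊆ segment ℝ (v i) (w i) :=
        (convex_segment _ _).segment_subset (left_mem_segment _ _ _) (hp i)
      refine Infinite.mono hsub ?_
      rw [segment_eq_image_lineMap]
      exact (Icc_infinite zero_lt_one).image
        (AffineMap.lineMap_injective ℝ ((htri₁ i).ne hβ')).injOn
    have hS : segment ℝ (v i) (w i) ⊆ frontier R := by
      rw [hfr]; exact subset_iUnion (fun i => segment ℝ (v i) (w i)) i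
    obtain ⟨q, hq, hqinf⟩ : ∃ q ∈ T,
        (segment ℝ (v i) (w i) ∩ segment ℝ q.1 q.2).Infinite := by
      by_contra! hcon
      refine hinf ((T.finite_toSet.biUnion (t := fun q =>
        segment ℝ (v i) (w i) ∩ segment ℝ q.1 q.2) fun q hq => ?_).subset ?_)
      · exact not_infinite.1 (by simpa using hcon q (by simpa using hq))
      · intro x hx
        have := hS hx
        rw [hfT] at this
        simp only [mem_iUnion, exists_prop] at this ⊢
        obtain ⟨q, hq, hxq⟩ := this
        exact ⟨q, by simpa using hq, hx, hxq⟩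
    obtain ⟨y, hy, z, hz, hyz⟩ := hqinf.nontrivial
    refine ⟨q, hq, y, z, hyz, hy.2, hz.2, ?_⟩
    obtain ⟨a, b, hab⟩ := exists_segment_eq_union hyz hy.1 hz.1 hy.2 hz.2
    have := hmax i a b (hab ▸ subset_union_left) (by
      rw [hab]
      refine union_subset hS ?_
      rw [hfT]
      exact subset_biUnion_of_mem (u := fun q : Plane × Plane => segment ℝ q.1 q.2) hq)
    rw [← this, hab]
    exact subset_union_right
  choose k hkT hk using hex
  have hinj : ∀ i j, k i = k j → segment ℝ (v i) (w i) = segment ℝ (v j) (w j) := by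
    intro i j hij
    obtain ⟨y, z, hyz, hy, hz, hs⟩ := hk i
    obtain ⟨-, -, -, -, -, hs'⟩ := hk j
    rw [← hij] at hs'
    obtain ⟨a, b, hab⟩ := exists_segment_eq_union hyz (hs hy) (hs hz) (hs' hy) (hs' hz)
    have hsub : segment ℝ a b ⊆ frontier R := by
      rw [hab, hfr]
      exact union_subset (subset_iUnion (fun i => segment ℝ (v i) (w i)) i)
        (subset_iUnion (fun i => segment ℝ (v i) (w i)) j)
    rw [← hmax i a b (hab ▸ subset_union_left) hsub, hmax j a b (hab ▸ subset_union_right) hsub]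
  let rep : Plane × Plane → Finset (Plane × Plane) := fun q =>
    if h : ∃ i, k i = q then {(v h.choose, p h.choose), (p h.choose, w h.choose)} else ∅
  refine ⟨T.biUnion rep, ?_, ?_, ?_⟩
  · refine (Finset.card_biUnion_le_card_mul _ _ 2 fun q _ => ?_).trans (by lia)
    by_cases h : ∃ i, k i = q
    · simp only [rep, dif_pos h]; exact Finset.card_le_two
    · simp [rep, dif_neg h]
  · intro q' hq'
    obtain ⟨q, -, hq⟩ := Finset.mem_biUnion.1 hq'
    by_cases h : ∃ i, k i = q
    · simp only [rep, dif_pos h, Finset.mem_insert, Finset.mem_singleton] at hq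
      rcases hq with rfl | rfl
      · exact htri₁ _
      · exact htri₂ _
    · simp [rep, dif_neg h] at hq
  · intro x hx
    rw [hfr] at hx
    obtain ⟨i, hi⟩ := mem_iUnion.1 hx
    have h : ∃ j, k j = k i := ⟨i, rfl⟩
    rw [← hinj _ _ h.choose_spec] at hi
    have hmem : ∀ q ∈ rep (k i), q ∈ T.biUnion rep := fun q hq =>
      Finset.mem_biUnion.2 ⟨_, hkT i, hq⟩
    have hi' : x ∈ segment ℝ (v h.choose) (p h.choose) ∪ segment ℝ (p h.choose) (w h.choose) :=
      segment_subset_union_of_mem (hp _) hi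
    rcases hi' with hi' | hi'
    · exact mem_biUnion (hmem (v h.choose, p h.choose) (by simp [rep, dif_pos h])) hi'
    · exact mem_biUnion (hmem (p h.choose, w h.choose) (by simp [rep, dif_pos h])) hi'

/-- Locally at `p`, the set `A` contains the line through `p` in direction `d`. -/
def ContainsLineNear (A : Set Plane) (p d : Plane) : Prop :=
  ∃ ε > 0, ∀ t : ℝ, |t| ≤ ε → p + t • d ∈ A

theorem ContainsLineNear.mono {A B : Set Plane} {p d : Plane} (hAB : A ⊆ B)
    (h : ContainsLineNear A p d) : ContainsLineNear B p d := by
  obtain ⟨ε, hε, h⟩ := h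
  exact ⟨ε, hε, fun t ht => hAB (h t ht)⟩

theorem containsLineNear_of_mem_interior {A : Set Plane} {p : Plane} (hp : p ∈ interior A)
    (d : Plane) : ContainsLineNear A p d := by
  have hcont : Filter.Tendsto (fun t : ℝ => p + t • d) (nhds 0) (nhds p) := by
    have : Continuous fun t : ℝ => p + t • d := by fun_prop
    simpa using this.tendsto 0
  obtain ⟨ε, hε, h⟩ := Metric.eventually_nhds_iff_ball.1
    (hcont.eventually (mem_interior_iff_mem_nhds.1 hp))
  refine ⟨ε / 2, half_pos hε, fun t ht => h t ?_⟩
  rw [mem_ball_zero_iff, Real.norm_eq_abs]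
  linarith

theorem containsLineNear_segment {a b p y : Plane} (hp : p ∈ openSegment ℝ a b)
    (hy : y ∈ segment ℝ a b) : ContainsLineNear (segment ℝ a b) p (y - p) := by
  rw [openSegment_eq_image_lineMap] at hp
  rw [segment_eq_image_lineMap] at hy ⊢
  obtain ⟨s, hs, rfl⟩ := hp
  obtain ⟨r, hr, rfl⟩ := hy
  refine ⟨min s (1 - s), lt_min hs.1 (by linarith [hs.2]), fun t ht => ?_⟩
  refine ⟨s + t * (r - s), ?_, ?_⟩
  · have h₁ : |t * (r - s)| ≤ min s (1 - s) := by
      rw [abs_mul]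
      have : |r - s| ≤ 1 := abs_le.2 ⟨by linarith [hs.2, hr.1], by linarith [hs.1, hr.2]⟩
      nlinarith [abs_nonneg t]
    obtain ⟨h₂, h₃⟩ := abs_le.1 h₁
    have := min_le_left s (1 - s)
    have := min_le_right s (1 - s)
    constructor <;> linarith
  · simp only [AffineMap.lineMap_apply_module]
    module

/-- A connected component of `A` contains every preconnected subset of `A` it meets. -/
theorem IsConnCompOf.subset_of_isPreconnected {A U V : Set Plane} (h : IsConnCompOf A U)
    (hV : IsPreconnected V) (hVA : V ⊆ A) {p : Plane} (hpU : p ∈ U) (hpV : p ∈ V) : V ⊆ U := by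
  have := h.2.2.2 (U ∪ V) subset_union_left (union_subset h.1 hVA)
    (h.2.2.1.union p hpU hpV hV)
  exact this ▸ subset_union_right

/-- Connected components are determined by any of their points. -/
theorem IsConnCompOf.eq_of_mem {A U V : Set Plane} (hU : IsConnCompOf A U)
    (hV : IsConnCompOf A V) {p : Plane} (hpU : p ∈ U) (hpV : p ∈ V) : U = V :=
  (hV.subset_of_isPreconnected hU.2.2.1 hU.1 hpV hpU).antisymm
    (hU.subset_of_isPreconnected hV.2.2.1 hV.1 hpU hpV)

/-- A compact connected component of `A ∩ B` has a point through which `A` and `B` do not both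
contain a common line segment. -/
theorem IsConnCompOf.exists_extreme {A B U : Set Plane} (h : IsConnCompOf (A ∩ B) U)
    (hc : IsCompact U) : ∃ p ∈ U, ∀ d, ContainsLineNear A p d → ContainsLineNear B p d → d = 0 := by
  obtain ⟨p, hp, hmax⟩ := hc.exists_isMaxOn h.2.1 continuous_norm.continuousOn
  refine ⟨p, hp, ?_⟩
  rintro d ⟨ε₁, hε₁, h₁⟩ ⟨ε₂, hε₂, h₂⟩
  set ε := min ε₁ ε₂
  have hε : 0 < ε := lt_min hε₁ hε₂
  set V : Set Plane := (fun t : ℝ => p + t • d) '' Icc (-ε) ε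
  have hV : V ⊆ U := by
    refine h.subset_of_isPreconnected (p := p) ?_ ?_ hp ⟨0, ⟨by linarith, hε.le⟩, by simp⟩
    · exact isPreconnected_Icc.image _ (by fun_prop)
    · rintro _ ⟨t, ht, rfl⟩
      have := abs_le.2 ht
      exact ⟨h₁ t (this.trans (min_le_left _ _)), h₂ t (this.trans (min_le_right _ _))⟩
  have m₁ : ‖p + ε • d‖ ≤ ‖p‖ := hmax (hV ⟨ε, ⟨by linarith, le_rfl⟩, rfl⟩)
  have m₂ : ‖p - ε • d‖ ≤ ‖p‖ := hmax (hV ⟨-ε, ⟨le_rfl, by linarith⟩, by simp [sub_eq_add_neg]⟩)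
  have hpar := parallelogram_law_with_norm ℝ p (ε • d)
  have hz : ‖ε • d‖ = 0 := by
    have := norm_nonneg (ε • d)
    have := norm_nonneg (p + ε • d)
    have := norm_nonneg (p - ε • d)
    nlinarith
  rw [norm_eq_zero, smul_eq_zero] at hz
  exact hz.resolve_left hε.ne'

/-- The segments `q` in `P` are edges, carrying good triangles, which cover the frontier of the
closed set `R`. -/
structure IsEdgeCover (β : ℝ) (R : Set Plane) (P : Finset (Plane × Plane)) : Prop where
  isClosed : IsClosed R
  good : ∀ q ∈ P, HasGoodTriangle β R q.1 q.2
  frontier_subset : frontier R ⊆ ⋃ q ∈ P, segment ℝ q.1 q.2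

theorem IsEdgeCover.segment_subset {β : ℝ} {R : Set Plane} {P : Finset (Plane × Plane)}
    (h : IsEdgeCover β R P) {q : Plane × Plane} (hq : q ∈ P) : segment ℝ q.1 q.2 ⊆ R := by
  obtain ⟨c, hc, -⟩ := h.good q hq
  rw [← convexHull_pair]
  exact (convexHull_mono (by grind)).trans hc

/-- A point of `R` is an endpoint of an edge, an inner point of an edge or an interior point. -/
theorem IsEdgeCover.cases_of_mem {β : ℝ} {R : Set Plane} {P : Finset (Plane × Plane)}
    (h : IsEdgeCover β R P) {p : Plane} (hp : p ∈ R) :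
    (∃ q ∈ P, p = q.1 ∨ p = q.2) ∨ (∃ q ∈ P, p ∈ openSegment ℝ q.1 q.2) ∨ p ∈ interior R := by
  by_cases hi : p ∈ interior R
  · exact Or.inr (Or.inr hi)
  have hf : p ∈ frontier R := by
    rw [h.isClosed.frontier_eq]
    exact ⟨hp, hi⟩
  obtain ⟨q, hq, hpq⟩ := mem_iUnion₂.1 (h.frontier_subset hf)
  rw [← insert_endpoints_openSegment] at hpq
  rcases hpq with hpq | hpq | hpq
  · exact Or.inl ⟨q, hq, Or.inl hpq⟩
  · exact Or.inl ⟨q, hq, Or.inr hpq⟩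
  · exact Or.inr (Or.inl ⟨q, hq, hpq⟩)

/-- A point through which two sets with edge covers contain no common line is an endpoint of an
edge, or the only common point of two edges. -/
theorem IsEdgeCover.cases_of_extreme {β : ℝ} (hβ' : β ≤ Real.pi / 3) {A B : Set Plane}
    {P P' : Finset (Plane × Plane)} (hA : IsEdgeCover β A P) (hB : IsEdgeCover β B P') {p : Plane}
    (hpA : p ∈ A) (hpB : p ∈ B)
    (hp : ∀ d, ContainsLineNear A p d → ContainsLineNear B p d → d = 0) :
    (∃ q ∈ P, p = q.1 ∨ p = q.2) ∨ (∃ q ∈ P', p = q.1 ∨ p = q.2) ∨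
      ∃ q ∈ P, ∃ q' ∈ P', segment ℝ q.1 q.2 ∩ segment ℝ q'.1 q'.2 = {p} := by
  have hopen : ∀ q : Plane × Plane, p ∈ openSegment ℝ q.1 q.2 → q.1 ≠ q.2 → q.2 - p ≠ 0 := by
    intro q hq hne h0
    rw [← sub_eq_zero.1 h0, right_mem_openSegment_iff] at hq
    exact hne hq
  rcases hA.cases_of_mem hpA with h | ⟨q, hq, hpq⟩ | hi
  · exact Or.inl h
  · rcases hB.cases_of_mem hpB with h | ⟨q', hq', hpq'⟩ | hi'
    · exact Or.inr (Or.inl h)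
    · refine Or.inr (Or.inr ⟨q, hq, q', hq', ?_⟩)
      refine Subset.antisymm (fun y hy => ?_) (singleton_subset_iff.2
        ⟨openSegment_subset_segment _ _ _ hpq, openSegment_subset_segment _ _ _ hpq'⟩)
      exact sub_eq_zero.1 (hp (y - p)
        ((containsLineNear_segment hpq hy.1).mono (hA.segment_subset hq))
        ((containsLineNear_segment hpq' hy.2).mono (hB.segment_subset hq')))
    · exact absurd (hp _ ((containsLineNear_segment hpq (right_mem_segment _ _ _)).mono
        (hA.segment_subset hq)) (containsLineNear_of_mem_interior hi' _))
        (hopen q hpq ((hA.good q hq).ne hβ'))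
  · rcases hB.cases_of_mem hpB with h | ⟨q', hq', hpq'⟩ | hi'
    · exact Or.inr (Or.inl h)
    · exact absurd (hp _ (containsLineNear_of_mem_interior hi _)
        ((containsLineNear_segment hpq' (right_mem_segment _ _ _)).mono
        (hB.segment_subset hq'))) (hopen q' hpq' ((hB.good q' hq').ne hβ'))
    · have := hp (EuclideanSpace.single 0 1) (containsLineNear_of_mem_interior hi _)
        (containsLineNear_of_mem_interior hi' _)
      simp at this

/-- Near a point of `R`, there are balls in `R` of radius comparable to any small scale. -/
theorem IsEdgeCover.eventually_exists_ball_subset {β : ℝ} (hβ : 0 < β) (hβ' : β ≤ Real.pi / 3)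
    {R : Set Plane} {P : Finset (Plane × Plane)} (h : IsEdgeCover β R P) {p : Plane}
    (hp : p ∈ R) : ∀ᶠ l in nhdsWithin (0 : ℝ) (Ioi 0),
      ∃ z, dist z p ≤ 3 * l ∧ ball z (Real.tan β / 12 * l) ⊆ R := by
  by_cases hi : p ∈ interior R
  · obtain ⟨ε, hε, hball⟩ := Metric.mem_nhds_iff.1 (mem_interior_iff_mem_nhds.1 hi)
    have hcont : Filter.Tendsto (fun l : ℝ => Real.tan β / 12 * l) (nhdsWithin 0 (Ioi 0))
        (nhds 0) := by
      have : Continuous fun l : ℝ => Real.tan β / 12 * l := by fun_prop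
      simpa using (this.tendsto 0).mono_left nhdsWithin_le_nhds
    filter_upwards [hcont.eventually (gt_mem_nhds hε), self_mem_nhdsWithin] with l hl hl0
    rw [mem_Ioi] at hl0
    exact ⟨p, by simp [hl0.le], (ball_subset_ball hl.le).trans hball⟩
  · have hf : p ∈ frontier R := by
      rw [h.isClosed.frontier_eq]
      exact ⟨hp, hi⟩
    obtain ⟨q, hq, hpq⟩ := mem_iUnion₂.1 (h.frontier_subset hf)
    have hd : 0 < dist q.1 q.2 := dist_pos.2 ((h.good q hq).ne hβ')
    filter_upwards [Ioc_mem_nhdsGT hd] with l hl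
    obtain ⟨z, hz, hzR⟩ := (h.good q hq).exists_ball_subset hβ hβ' hpq hl.1 hl.2
    exact ⟨z, by linarith [hl.1], hzR⟩

/-- The triples `(i, j, p)` which come from an edge of `R i`: either `p` is an endpoint of an edge
of `R i` and lies in `R' j`, or it is the only common point of an edge of `R i` and a longer edge
of `R' j`. There are only linearly many of them. -/
theorem exists_finset_edge_incidences {β : ℝ} (hβ : 0 < β) (hβ' : β ≤ Real.pi / 3) (N : ℕ) :
    ∃ K : ℕ, ∀ {ι κ : Type} [Fintype ι] [Fintype κ] (R' : κ → Set Plane)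
      (P : ι → Finset (Plane × Plane)) (P' : κ → Finset (Plane × Plane)),
      (∀ i j, i ≠ j → interior (R' i) ∩ interior (R' j) = ∅) →
      (∀ i, (P i).card ≤ N) → (∀ i, ∀ q ∈ P i, q.1 ≠ q.2) → (∀ j, (P' j).card ≤ N) → (∀ j, IsEdgeCover β (R' j) (P' j)) →
      ∃ F : Finset ((ι × κ) × Plane), F.card ≤ Fintype.card ι * K ∧
        (∀ i j p, p ∈ R' j → (∃ q ∈ P i, p = q.1 ∨ p = q.2) → ((i, j), p) ∈ F) ∧
        ∀ i j p, ∀ q ∈ P i, ∀ q' ∈ P' j, dist q.1 q.2 ≤ dist q'.1 q'.2 →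
          segment ℝ q.1 q.2 ∩ segment ℝ q'.1 q'.2 = {p} → ((i, j), p) ∈ F := by
  have ht : 0 < Real.tan β := Real.tan_pos_of_pos_of_lt_pi_div_two hβ (by linarith [Real.pi_pos])
  obtain ⟨K, hK⟩ := exists_card_filter_ball_subset_le (show 0 < Real.tan β / 12 by positivity)
  refine ⟨N * (2 * K) + N * (K * N), fun {ι κ} _ _ R' P P' hdisj hP hne hP' hcov => ?_⟩
  have hpt : ∀ p, (Finset.univ.filter fun j => p ∈ R' j).card ≤ K := by
    intro p
    have : ∀ᶠ l in nhdsWithin (0 : ℝ) (Ioi 0), ∀ j, p ∈ R' j →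
        ∃ z, dist z p ≤ 3 * l ∧ ball z (Real.tan β / 12 * l) ⊆ R' j :=
      Filter.eventually_all.2 fun j => by
        by_cases hp : p ∈ R' j
        · filter_upwards [(hcov j).eventually_exists_ball_subset hβ hβ' hp] with l hl _ using hl
        · simp [hp]
    obtain ⟨l, hl, hl0⟩ := (this.and self_mem_nhdsWithin).exists
    exact (Finset.card_le_card (Finset.monotone_filter_right _ fun j _ hj => hl j hj)).trans
      (hK R' hdisj p hl0)
  have hedge : ∀ q : Plane × Plane, q.1 ≠ q.2 → (Finset.univ.filter fun j => ∃ q' ∈ P' j,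
      dist q.1 q.2 ≤ dist q'.1 q'.2 ∧
      (segment ℝ q.1 q.2 ∩ segment ℝ q'.1 q'.2).Nonempty).card ≤ K := by
    intro q hq
    have hl := dist_pos.2 hq
    refine (Finset.card_le_card (Finset.monotone_filter_right _ fun j _ hj => ?_)).trans
      (hK R' hdisj q.1 hl)
    obtain ⟨q', hq', hle, x, hx, hx'⟩ := hj
    obtain ⟨z, hz, hzR⟩ := ((hcov j).good q' hq').exists_ball_subset hβ hβ' hx' hl hle
    have hxq : dist x q.1 ≤ dist q.1 q.2 := by
      have := (convex_closedBall q.1 (dist q.1 q.2)).segment_subset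
        (mem_closedBall_self hl.le) (by simp [dist_comm]) hx
      exact mem_closedBall.1 this
    exact ⟨z, by linarith [dist_triangle z x q.1], hzR⟩
  let F₁ : Finset ((ι × κ) × Plane) := Finset.univ.biUnion fun i => (P i).biUnion fun q =>
    ({q.1, q.2} : Finset Plane).biUnion fun p =>
      (Finset.univ.filter fun j => p ∈ R' j).image fun j => ((i, j), p)
  let F₂ : Finset ((ι × κ) × Plane) := Finset.univ.biUnion fun i => (P i).biUnion fun q =>
    (Finset.univ.filter fun j => ∃ q' ∈ P' j, dist q.1 q.2 ≤ dist q'.1 q'.2 ∧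
      (segment ℝ q.1 q.2 ∩ segment ℝ q'.1 q'.2).Nonempty).biUnion fun j =>
      (P' j).image fun q' =>
        ((i, j), Classical.epsilon fun p => p ∈ segment ℝ q.1 q.2 ∩ segment ℝ q'.1 q'.2)
  have hF₁ : F₁.card ≤ Fintype.card ι * (N * (2 * K)) := by
    refine Finset.card_biUnion_le_card_mul _ _ _ fun i _ => ?_
    refine (Finset.card_biUnion_le_card_mul _ _ (2 * K) fun q _ => ?_).trans
      (Nat.mul_le_mul_right _ (hP i))
    refine (Finset.card_biUnion_le_card_mul _ _ K fun p _ => ?_).trans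
      (Nat.mul_le_mul_right _ Finset.card_le_two)
    exact Finset.card_image_le.trans (hpt p)
  have hF₂ : F₂.card ≤ Fintype.card ι * (N * (K * N)) := by
    refine Finset.card_biUnion_le_card_mul _ _ _ fun i _ => ?_
    refine (Finset.card_biUnion_le_card_mul _ _ (K * N) fun q hq => ?_).trans
      (Nat.mul_le_mul_right _ (hP i))
    refine (Finset.card_biUnion_le_card_mul _ _ N fun j _ => ?_).trans
      (Nat.mul_le_mul_right _ (hedge q (hne i q hq)))
    exact Finset.card_image_le.trans (hP' j)
  refine ⟨F₁ ∪ F₂, ?_, ?_, ?_⟩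
  · rw [Nat.mul_add]
    exact (Finset.card_union_le _ _).trans (Nat.add_le_add hF₁ hF₂)
  · rintro i j p hp ⟨q, hq, hpq⟩
    refine Finset.mem_union_left _ (Finset.mem_biUnion.2 ⟨i, Finset.mem_univ _,
      Finset.mem_biUnion.2 ⟨q, hq, Finset.mem_biUnion.2 ⟨p, by simpa using hpq,
      Finset.mem_image.2 ⟨j, by simpa using hp, rfl⟩⟩⟩⟩)
  · intro i j p q hq q' hq' hle hpq
    refine Finset.mem_union_right _ (Finset.mem_biUnion.2 ⟨i, Finset.mem_univ _,
      Finset.mem_biUnion.2 ⟨q, hq, Finset.mem_biUnion.2 ⟨j, ?_,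
      Finset.mem_image.2 ⟨q', hq', ?_⟩⟩⟩⟩)
    · exact Finset.mem_filter.2 ⟨Finset.mem_univ _, q', hq', hle, hpq ▸ singleton_nonempty p⟩
    · have : Classical.epsilon (fun y => y ∈ segment ℝ q.1 q.2 ∩ segment ℝ q'.1 q'.2) = p := by
        have := Classical.epsilon_spec
          (p := fun y => y ∈ segment ℝ q.1 q.2 ∩ segment ℝ q'.1 q'.2) ⟨p, by simp [hpq]⟩
        exact hpq.subset this
      rw [this]

/-- **The number of maximal connected components of intersections of two ring partitions
of `Ω` is at most `c·n`.** -/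
theorem card_intersections_of_ring_partitions (N₀ : ℕ) (c₀ β : ℝ) (hc₀ : 1 ≤ c₀) (hβ : 0 < β) (hβ' : β ≤ Real.pi / 3) :
    ∃ c : ℝ, 0 < c ∧
      ∀ (Ω : Set Plane) (n₀ : ℕ), IsCompact Ω → IsRingDecomp N₀ c₀ β n₀ Ω →
        ∀ (n m m' : ℕ), m ≤ n → m' ≤ n →
          ∀ (R : Fin m → Set Plane) (R' : Fin m' → Set Plane),
            (∀ i, IsRing N₀ c₀ β (R i)) →
            (∀ i j, i ≠ j → interior (R i) ∩ interior (R j) = ∅) →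
            (⋃ i, R i) = Ω →
            (∀ i, IsRing N₀ c₀ β (R' i)) →
            (∀ i j, i ≠ j → interior (R' i) ∩ interior (R' j) = ∅) →
            (⋃ i, R' i) = Ω →
            ({U ∈ {U : Set Plane | IsCompact U ∧ U = closure (interior U) ∧
                ∃ i j, IsConnCompOf (R i ∩ R' j) U} |
              ∀ V ∈ {U : Set Plane | IsCompact U ∧ U = closure (interior U) ∧
                ∃ i j, IsConnCompOf (R i ∩ R' j) U}, U ⊆ V → V = U}.Finite ∧
            (({U ∈ {U : Set Plane | IsCompact U ∧ U = closure (interior U) ∧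
                ∃ i j, IsConnCompOf (R i ∩ R' j) U} |
              ∀ V ∈ {U : Set Plane | IsCompact U ∧ U = closure (interior U) ∧
                ∃ i j, IsConnCompOf (R i ∩ R' j) U}, U ⊆ V → V = U}).ncard : ℝ) ≤ c * n) := by
  obtain ⟨K, hK⟩ := exists_finset_edge_incidences hβ hβ' (4 * N₀)
  refine ⟨2 * K + 1, by positivity, ?_⟩
  intro Ω n₀ _ _ n m m' hm hm' R R' hR hd _ hR' hd' _
  have hE : ∀ i, ∃ P : Finset (Plane × Plane), P.card ≤ 4 * N₀ ∧ IsEdgeCover β (R i) P := fun i => by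
    obtain ⟨hc, P, h₁, h₂, h₃⟩ := (hR i).exists_edges hβ'
    exact ⟨P, h₁, hc, h₂, h₃⟩
  have hE' : ∀ i, ∃ P : Finset (Plane × Plane), P.card ≤ 4 * N₀ ∧ IsEdgeCover β (R' i) P :=
    fun i => by
      obtain ⟨hc, P, h₁, h₂, h₃⟩ := (hR' i).exists_edges hβ'
      exact ⟨P, h₁, hc, h₂, h₃⟩
  choose P hP hcov using hE
  choose P' hP' hcov' using hE'
  obtain ⟨F, hF, hF₁, hF₂⟩ := hK R' P P' hd' hP
    (fun i q hq => ((hcov i).good q hq).ne hβ') hP' hcov'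
  obtain ⟨F', hF', hF₁', hF₂'⟩ := hK R P' P hd hP'
    (fun i q hq => ((hcov' i).good q hq).ne hβ') hP hcov
  set G : Finset ((Fin m × Fin m') × Plane) := F ∪ F'.image fun t => (t.1.swap, t.2) with hG
  have hGcard : G.card ≤ 2 * K * n := by
    have h₁ := Finset.card_union_le F (F'.image fun t => (t.1.swap, t.2))
    have h₂ : (F'.image fun t => (t.1.swap, t.2)).card ≤ F'.card := Finset.card_image_le
    rw [Fintype.card_fin] at hF hF'
    have h₃ := Nat.mul_le_mul_right K hm
    have h₄ := Nat.mul_le_mul_right K hm'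
    rw [hG]
    linarith
  have hswap : ∀ i j p, ((j, i), p) ∈ F' → ((i, j), p) ∈ G := fun i j p h =>
    Finset.mem_union_right _ (Finset.mem_image.2 ⟨_, h, rfl⟩)
  set 𝒰 : Set (Set Plane) := {U ∈ {U : Set Plane | IsCompact U ∧ U = closure (interior U) ∧
                ∃ i j, IsConnCompOf (R i ∩ R' j) U} |
              ∀ V ∈ {U : Set Plane | IsCompact U ∧ U = closure (interior U) ∧
                ∃ i j, IsConnCompOf (R i ∩ R' j) U}, U ⊆ V → V = U}
  have hex : ∀ U ∈ 𝒰, ∃ t ∈ G, t.2 ∈ U ∧ IsConnCompOf (R t.1.1 ∩ R' t.1.2) U := by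
    rintro U ⟨⟨hc, -, i, j, hU⟩, -⟩
    obtain ⟨p, hpU, hp⟩ := hU.exists_extreme hc
    obtain ⟨hpi, hpj⟩ := hU.1 hpU
    refine ⟨((i, j), p), ?_, hpU, hU⟩
    rcases (hcov i).cases_of_extreme hβ' (hcov' j) hpi hpj hp with h | h | ⟨q, hq, q', hq', h⟩
    · exact Finset.mem_union_left _ (hF₁ i j p hpj h)
    · exact hswap i j p (hF₁' j i p hpi h)
    · rcases le_total (dist q.1 q.2) (dist q'.1 q'.2) with hle | hle
      · exact Finset.mem_union_left _ (hF₂ i j p q hq q' hq' hle h)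
      · exact hswap i j p (hF₂' j i p q' hq' q hq hle (by rwa [inter_comm]))
  let comp : (Fin m × Fin m') × Plane → Set Plane := fun t =>
    Classical.epsilon fun U => t.2 ∈ U ∧ IsConnCompOf (R t.1.1 ∩ R' t.1.2) U
  have hsub : 𝒰 ⊆ G.image comp := by
    intro U hU
    obtain ⟨t, ht, htU, hcomp⟩ := hex U hU
    obtain ⟨h₁, h₂⟩ := Classical.epsilon_spec
      (p := fun U => t.2 ∈ U ∧ IsConnCompOf (R t.1.1 ∩ R' t.1.2) U) ⟨U, htU, hcomp⟩
    exact Finset.mem_coe.2 (Finset.mem_image.2 ⟨t, ht, h₂.eq_of_mem hcomp h₁ htU⟩)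
  refine ⟨(Finset.finite_toSet _).subset hsub, ?_⟩
  have hcard : 𝒰.ncard ≤ 2 * K * n := by
    refine (ncard_le_ncard hsub (Finset.finite_toSet _)).trans ?_
    rw [ncard_coe_finset]
    exact Finset.card_image_le.trans hGcard
  calc (𝒰.ncard : ℝ) ≤ ((2 * K * n : ℕ) : ℝ) := Nat.cast_le.2 hcard
    _ ≤ (2 * K + 1) * n := by push_cast; nlinarith [(Nat.cast_nonneg n : (0 : ℝ) ≤ n)]

end
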